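/- Let (Q,d) be irreducible, where Q is 3-connected along the bond d and both sides of d contain edges. Then (Q,d) is the special K4 or the special prism. -/

import Mathlib

open SimpleGraph

/-- An edge set `X` is connected: any two vertices covered by `X` are joined by a path
consisting of edges of `X`.  (The empty edge set counts as connected.) -/
def EdgeSetConnected {V : Type*} (X : Set (Sym2 V)) : Prop :=
  ∀ u ∈ (fromEdgeSet X).support, ∀ v ∈ (fromEdgeSet X).support, (fromEdgeSet X).Reachable u v

/-- The subgraph `G[X]` spanned by an edge set `X`, as a graph on the covered vertices. -/
def edgeSubgraph {V : Type*} (X : Set (Sym2 V)) :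
    SimpleGraph ((fromEdgeSet X).support) :=
  (fromEdgeSet X).induce (fromEdgeSet X).support

/-- The number of connected components of `G[X]`. -/
noncomputable def edgeComponents {V : Type*} (X : Set (Sym2 V)) : ℕ :=
  Nat.card (edgeSubgraph X).ConnectedComponent

/-- A graph is `k`-connected if it has more than `k` vertices and deleting fewer than `k`
vertices always leaves a connected graph. -/
def KConnected {V : Type*} (k : ℕ) (G : SimpleGraph V) : Prop :=
  k < Nat.card V ∧ ∀ S : Set V, S.ncard < k → (G.induce Sᶜ).Connected

/-- A constraint graph: a finite simple graph `G` together with a set `X` of edges. -/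
structure CGraph : Type 1 where
  V : Type
  G : SimpleGraph V
  X : Set (Sym2 V)
  fin : Finite V := by infer_instance

attribute [instance] CGraph.fin

/-- `X` really is a set of edges of `G`. -/
def CGraph.WF (C : CGraph) : Prop := C.X ⊆ C.G.edgeSet

/-- The vertex map contracting `v` onto `u`. -/
noncomputable def contractFun {V : Type*} {u v : V} (huv : u ≠ v) (x : V) : {w : V // w ≠ v} :=
  letI := Classical.decEq V
  if h : x = v then ⟨u, huv⟩ else ⟨x, h⟩

/-- Contraction of a simple graph, identifying `v` with `u` (loops are discarded, parallel
edges are merged, so the result is simple). -/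
noncomputable def contractGraph {V : Type*} (G : SimpleGraph V) {u v : V} (huv : u ≠ v) :
    SimpleGraph {w : V // w ≠ v} :=
  fromEdgeSet (Sym2.map (contractFun huv) '' G.edgeSet)

/-- Contraction of a constraint graph: identify `v` with `u`; the new constraint consists of all
non-loop images of constraint edges; thus in each parallel class edges of `X` are preferred. -/
noncomputable def CGraph.contract (C : CGraph) (u v : C.V) (huv : u ≠ v) : CGraph where
  V := {w : C.V // w ≠ v}
  G := contractGraph C.G huv
  X := {e | e ∈ Sym2.map (contractFun huv) '' C.X ∧ ¬ e.IsDiag}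

/-- Deletion of an edge from a constraint graph. -/
def CGraph.deleteEdge (C : CGraph) (e : Sym2 C.V) : CGraph where
  V := C.V
  G := C.G.deleteEdges {e}
  X := C.X

/-- One step in forming a constraint minor: delete an edge not in `X`, or contract an edge. -/
inductive CMinorStep : CGraph → CGraph → Prop
  | del (C : CGraph) (e : Sym2 C.V) (he : e ∈ C.G.edgeSet) (hx : e ∉ C.X) :
      CMinorStep C (C.deleteEdge e)
  | contr (C : CGraph) (u v : C.V) (h : C.G.Adj u v) :
      CMinorStep C (C.contract u v h.ne)

/-- The constraint-minor relation. -/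
def IsCMinor : CGraph → CGraph → Prop := Relation.ReflTransGen CMinorStep

/-- Isomorphism of constraint graphs. -/
def CGIso (C D : CGraph) : Prop :=
  ∃ φ : C.G ≃g D.G, Sym2.map (⇑φ) '' C.X = D.X

/-- The constraint `K₄`. -/
def constraintK4 : CGraph where
  V := Fin 4
  G := ⊤
  X := {s(0, 1), s(2, 3)}

def wheelGraph : SimpleGraph (Fin 5) :=
  fromEdgeSet {s(0, 1), s(1, 2), s(2, 3), s(3, 0), s(0, 4), s(1, 4), s(2, 4), s(3, 4)}

/-- The constraint wheel. -/
def constraintWheel : CGraph where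
  V := Fin 5
  G := wheelGraph
  X := {s(0, 1), s(2, 3)}

/-- The prism `K₃ □ K₂`, with triangles `{0,1,2}` and `{3,4,5}`. -/
def prismGraph : SimpleGraph (Fin 6) :=
  fromEdgeSet {s(0, 1), s(1, 2), s(0, 2), s(3, 4), s(4, 5), s(3, 5), s(0, 3), s(1, 4), s(2, 5)}

def topEdges : Set (Sym2 (Fin 6)) := {s(0, 1), s(1, 2), s(0, 2)}
def botEdges : Set (Sym2 (Fin 6)) := {s(3, 4), s(4, 5), s(3, 5)}

/-- Constraint sets of the four constraint prisms: contained in the two triangles and meeting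
every vertex, inducing a spanning connected subgraph of each triangle. -/
def PrismConstraintSet (X : Set (Sym2 (Fin 6))) : Prop :=
  X ⊆ topEdges ∪ botEdges ∧
  EdgeSetConnected (X ∩ topEdges) ∧ (fromEdgeSet (X ∩ topEdges)).support = {0, 1, 2} ∧
  EdgeSetConnected (X ∩ botEdges) ∧ (fromEdgeSet (X ∩ botEdges)).support = {3, 4, 5}

/-- `C` is one of the four constraint prisms. -/
def IsConstraintPrism (C : CGraph) : Prop :=
  ∃ X, PrismConstraintSet X ∧ CGIso C (CGraph.mk (Fin 6) prismGraph X)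

/-- The six obstructions. -/
def IsObstruction (D : CGraph) : Prop :=
  CGIso D constraintK4 ∨ CGIso D constraintWheel ∨ IsConstraintPrism D

/-- The weird prism. -/
def weirdPrism : CGraph where
  V := Fin 6
  G := prismGraph
  X := {s(0, 3), s(1, 4), s(2, 5)}

/-- The Wagner graph `V₈`. -/
def wagnerGraph : SimpleGraph (Fin 8) :=
  fromEdgeSet {s(0, 1), s(1, 2), s(2, 3), s(3, 4), s(4, 5), s(5, 6), s(6, 7), s(7, 0),
    s(0, 4), s(1, 5), s(2, 6), s(3, 7)}

/-- The constraint Wagner graph: `X` is the complement of the 6-cycle `0-1-5-4-3-7-0`. -/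
def constraintWagner : CGraph where
  V := Fin 8
  G := wagnerGraph
  X := {s(1, 2), s(2, 3), s(5, 6), s(6, 7), s(0, 4), s(2, 6)}

/-- The Wagner prism. -/
def wagnerPrism : CGraph where
  V := Fin 6
  G := prismGraph
  X := {s(0, 3), s(1, 2), s(4, 5)}

/-- `(G, X)` has a 3-connected constraint minor whose constraint is disconnected. -/
def BadMinor (C : CGraph) : Prop :=
  ∃ C', IsCMinor C C' ∧ KConnected 3 C'.G ∧ ¬ EdgeSetConnected C'.X

/-- An edge `e ∉ X` is essential if neither `(G/e, X ∩ E(G/e))` nor `(G∖e, X)` has a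
3-connected constraint minor with disconnected constraint. -/
def Essential (C : CGraph) (e : Sym2 C.V) : Prop :=
  ¬ BadMinor (C.deleteEdge e) ∧
  ∀ u v, ∀ h : C.G.Adj u v, s(u, v) = e → ¬ BadMinor (C.contract u v h.ne)

/-- An edge joining two distinct components of `G[X]`. -/
def JoinsComponents {V : Type*} (X : Set (Sym2 V)) (e : Sym2 V) : Prop :=
  ∃ a b, e = s(a, b) ∧ a ∈ (fromEdgeSet X).support ∧ b ∈ (fromEdgeSet X).support ∧
    ¬ (fromEdgeSet X).Reachable a b

/-- The degree of a vertex. -/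
noncomputable def vdeg {V : Type*} (G : SimpleGraph V) (v : V) : ℕ := (G.neighborSet v).ncard

/-- The component of `G[X]` containing the edge `f` consists of the single edge `f`. -/
def SingleEdgeComponent {V : Type*} (X : Set (Sym2 V)) (f : Sym2 V) : Prop :=
  f ∈ X ∧ ∀ g ∈ X, (∃ a ∈ f, ∃ b ∈ g, (fromEdgeSet X).Reachable a b) → g = f

/-- The edges of `Q` with all endvertices in `S`: the edges of the side `Q[S]`. -/
def sideEdges {V : Type*} (Q : SimpleGraph V) (S : Set V) : Set (Sym2 V) :=
  {e | e ∈ Q.edgeSet ∧ ∀ v ∈ e, v ∈ S}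

/-- The edges of `Q` with one endvertex in `S` and one outside `S`. -/
def crossEdges {V : Type*} (Q : SimpleGraph V) (S : Set V) : Set (Sym2 V) :=
  {e | e ∈ Q.edgeSet ∧ (∃ v ∈ e, v ∈ S) ∧ ∃ v ∈ e, v ∉ S}

/-- `d` is a bond of `Q` with sides induced by `S` and `Sᶜ`. -/
def IsBondWith {V : Type*} (Q : SimpleGraph V) (d : Set (Sym2 V)) (S : Set V) : Prop :=
  S.Nonempty ∧ Sᶜ.Nonempty ∧ (Q.induce S).Connected ∧ (Q.induce Sᶜ).Connected ∧
    d = crossEdges Q S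

/-- `Q` is 3-connected along the bond `d` (with left side `S`): `Q` is 2-connected and no pair
of vertices, one from each side, separates `Q`. -/
def ThreeConnAlong {V : Type*} (Q : SimpleGraph V) (d : Set (Sym2 V)) (S : Set V) : Prop :=
  IsBondWith Q d S ∧ KConnected 2 Q ∧
    ∀ x ∈ S, ∀ y ∈ Sᶜ, (Q.induce ({x, y}ᶜ : Set V)).Preconnected

/-- One step of a special contraction minor: contract an edge not in the bond. -/
inductive SCMStep : CGraph → CGraph → Prop
  | contr (C : CGraph) (u v : C.V) (h : C.G.Adj u v) (hd : s(u, v) ∉ C.X) :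
      SCMStep C (C.contract u v h.ne)

/-- The special-contraction-minor relation. -/
def IsSCMinor : CGraph → CGraph → Prop := Relation.ReflTransGen SCMStep

/-- A proper (non-identical) special contraction minor. -/
def IsProperSCMinor : CGraph → CGraph → Prop := Relation.TransGen SCMStep

/-- The special `K₄`: `K₄` together with a bond of size 4. -/
def specialK4 : CGraph where
  V := Fin 4
  G := ⊤
  X := {s(0, 2), s(0, 3), s(1, 2), s(1, 3)}

/-- The special prism: the prism together with the bond complementing the two triangles. -/
def specialPrism : CGraph where
  V := Fin 6
  G := prismGraph
  X := {s(0, 3), s(1, 4), s(2, 5)}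

/-- `(Q, d)` is 3-connected along `d` and both sides of `d` contain edges. -/
def GoodAlong (C : CGraph) : Prop :=
  ∃ S : Set C.V, ThreeConnAlong C.G C.X S ∧
    (sideEdges C.G S).Nonempty ∧ (sideEdges C.G Sᶜ).Nonempty

/-- `(Q, d)` is irreducible. -/
def BondIrreducible (C : CGraph) : Prop :=
  (∃ S : Set C.V, ThreeConnAlong C.G C.X S) ∧
  ¬ ∃ C', IsProperSCMinor C C' ∧ GoodAlong C'

/-- An edge set forming a triangle. -/
def IsTriangle {V : Type*} (X : Set (Sym2 V)) : Prop :=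
  ∃ a b c : V, a ≠ b ∧ a ≠ c ∧ b ≠ c ∧ X = {s(a, b), s(b, c), s(a, c)}

/-- An edge set consisting of a single edge. -/
def IsSingleEdge {V : Type*} (X : Set (Sym2 V)) : Prop :=
  ∃ a b : V, a ≠ b ∧ X = {s(a, b)}

/-- `M` is (isomorphic to) the cycle matroid of `G`, via the bijection `f` between the ground
set of `M` and the edges of `G`: a set is independent iff its image is a forest. -/
def IsGraphicRep {α : Type} (M : Matroid α) {V : Type} (G : SimpleGraph V)
    (f : α → Sym2 V) : Prop :=
  Set.BijOn f M.E G.edgeSet ∧ ∀ I ⊆ M.E, (M.Indep I ↔ (fromEdgeSet (f '' I)).IsAcyclic)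

/-- The constraint matroid `(M, X)` is realisable. -/
def Realisable {α : Type} (M : Matroid α) (X : Set α) : Prop :=
  ∃ (V : Type) (_ : Finite V) (G : SimpleGraph V) (f : α → Sym2 V),
    IsGraphicRep M G f ∧ EdgeSetConnected (f '' X)

/-- Deletion of a set of elements from a matroid. -/
def Matroid.del {α : Type} (M : Matroid α) (D : Set α) : Matroid α := Matroid.restrict M (M.E \ D)

/-- Contraction of a set of elements of a matroid. -/
def Matroid.con {α : Type} (M : Matroid α) (C : Set α) : Matroid α :=
  Matroid.dual (Matroid.del (Matroid.dual M) C)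

/-- `(N, Y)` is a constraint minor of `(M, X)`: contract an arbitrary set `C` and delete a
set `D` of elements not in `X`. -/
def MatroidCMinor {α : Type} (M : Matroid α) (X : Set α) (N : Matroid α) (Y : Set α) : Prop :=
  ∃ C D : Set α, D ⊆ M.E \ X ∧ N = (M.con C).del D ∧ Y = X \ C

/-- `(N, Y)` is isomorphic, via the cycle matroid, to one of the six obstructions. -/
def MatroidObstruction {α : Type} (N : Matroid α) (Y : Set α) : Prop :=
  (∃ f : α → Sym2 (Fin 4), IsGraphicRep N constraintK4.G f ∧ f '' Y = constraintK4.X) ∨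
  (∃ f : α → Sym2 (Fin 5), IsGraphicRep N constraintWheel.G f ∧ f '' Y = constraintWheel.X) ∨
  (∃ X, PrismConstraintSet X ∧
    ∃ f : α → Sym2 (Fin 6), IsGraphicRep N prismGraph f ∧ f '' Y = X)


/-! ### Cut-connectivity of vertex sets -/

/-- Preconnectedness of the vertex set `A`, in terms of closed subsets. -/
def PC {V : Type*} (G : SimpleGraph V) (A : Set V) : Prop :=
  ∀ X ⊆ A, X.Nonempty → (∀ x ∈ X, ∀ y ∈ A, G.Adj x y → y ∈ X) → A ⊆ X

/-- Connectedness of the vertex set `A`. -/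
def CC {V : Type*} (G : SimpleGraph V) (A : Set V) : Prop := A.Nonempty ∧ PC G A

theorem pc_iff {V : Type*} (G : SimpleGraph V) (A : Set V) :
    (G.induce A).Preconnected ↔ PC G A := by
  constructor
  · intro h X hXA hX hcl y hy
    obtain ⟨x, hx⟩ := hX
    obtain ⟨w⟩ := h ⟨x, hXA hx⟩ ⟨y, hy⟩
    have key : ∀ (a b : A) (_ : (G.induce A).Walk a b), (a : V) ∈ X → (b : V) ∈ X := by
      intro a b w
      induction w with
      | nil => exact id
      | cons hadj _ ih => exact fun ha => ih (hcl _ ha _ (Subtype.property _) hadj)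
    exact key _ _ w hx
  · intro h u v
    have := h {x | ∃ hx : x ∈ A, (G.induce A).Reachable u ⟨x, hx⟩} (fun x hx => hx.1)
      ⟨u, u.2, Reachable.refl _⟩ (by
        rintro x ⟨hx, hr⟩ y hy hadj
        refine ⟨hy, hr.trans (Adj.reachable ?_)⟩
        exact hadj)
    exact (this v.2).2

theorem cc_iff {V : Type*} (G : SimpleGraph V) (A : Set V) :
    (G.induce A).Connected ↔ CC G A := by
  rw [connected_iff, pc_iff, CC, Set.nonempty_coe_sort, and_comm]

theorem CC.singleton {V : Type*} (G : SimpleGraph V) (a : V) : CC G {a} := by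
  refine ⟨⟨a, rfl⟩, ?_⟩
  intro X hX hne _
  obtain ⟨x, hx⟩ := hne
  have := hX hx
  simp only [Set.mem_singleton_iff] at this
  subst this
  simpa using hx

theorem CC.union {V : Type*} {G : SimpleGraph V} {A B : Set V} (hA : CC G A) (hB : CC G B)
    {a b : V} (ha : a ∈ A) (hb : b ∈ B) (hab : G.Adj a b) : CC G (A ∪ B) := by
  refine ⟨⟨a, Or.inl ha⟩, ?_⟩
  intro X hX hne hcl
  have h1 : ∀ z ∈ X, z ∈ A → A ⊆ X := by
    intro z hz hzA
    have := hA.2 (X ∩ A) Set.inter_subset_right ⟨z, hz, hzA⟩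
      (fun x hx y hy h => ⟨hcl x hx.1 y (Or.inl hy) h, hy⟩)
    exact fun t ht => (this ht).1
  have h2 : ∀ z ∈ X, z ∈ B → B ⊆ X := by
    intro z hz hzB
    have := hB.2 (X ∩ B) Set.inter_subset_right ⟨z, hz, hzB⟩
      (fun x hx y hy h => ⟨hcl x hx.1 y (Or.inr hy) h, hy⟩)
    exact fun t ht => (this ht).1
  obtain ⟨z, hz⟩ := hne
  rcases hX hz with hzA | hzB
  · have hA' := h1 z hz hzA
    have hB' := h2 b (hcl a (hA' ha) b (Or.inr hb) hab) hb
    exact Set.union_subset hA' hB'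
  · have hB' := h2 z hz hzB
    have hA' := h1 a (hcl b (hB' hb) a (Or.inl ha) hab.symm) ha
    exact Set.union_subset hA' hB'

theorem CC.insert {V : Type*} {G : SimpleGraph V} {A : Set V} (hA : CC G A)
    {a b : V} (ha : a ∈ A) (hab : G.Adj a b) : CC G (insert b A) := by
  have := hA.union (CC.singleton G b) ha rfl hab
  rwa [Set.union_singleton] at this

/-- The component of `l` inside `U`. -/
theorem exists_component {V : Type*} [Finite V] (G : SimpleGraph V) (U : Set V) (l : V)
    (hl : l ∈ U) : ∃ K ⊆ U, l ∈ K ∧ CC G K ∧ ∀ x ∈ K, ∀ y ∈ U, G.Adj x y → y ∈ K := by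
  have hfin : {K : Set V | K ⊆ U ∧ l ∈ K ∧ CC G K}.Finite := Set.toFinite _
  obtain ⟨K, hK⟩ := hfin.exists_maximal
    ⟨{l}, Set.singleton_subset_iff.2 hl, rfl, CC.singleton G l⟩
  refine ⟨K, hK.prop.1, hK.prop.2.1, hK.prop.2.2, ?_⟩
  intro x hx y hy hxy
  have : insert y K ⊆ K := hK.le_of_ge (y := insert y K)
    ⟨Set.insert_subset hy hK.prop.1, Or.inr hK.prop.2.1, hK.prop.2.2.insert hx hxy⟩
    (Set.subset_insert _ _)
  exact this (Set.mem_insert _ _)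

/-- Two disjoint connected sets extend to a connected bipartition. -/
theorem extend_partition {V : Type*} [Finite V] {G : SimpleGraph V} {U A B : Set V}
    (hU : CC G U) (hA : CC G A) (hB : CC G B) (hAU : A ⊆ U) (hBU : B ⊆ U) (hd : Disjoint A B) :
    ∃ A', A ⊆ A' ∧ A' ⊆ U ∧ B ⊆ U \ A' ∧ CC G A' ∧ CC G (U \ A') := by
  have hfin : {p : Set V × Set V | A ⊆ p.1 ∧ B ⊆ p.2 ∧ p.1 ⊆ U ∧ p.2 ⊆ U ∧ Disjoint p.1 p.2 ∧
    CC G p.1 ∧ CC G p.2}.Finite := Set.toFinite _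
  obtain ⟨p, hp⟩ := hfin.exists_maximal ⟨(A, B), subset_rfl, subset_rfl, hAU, hBU, hd, hA, hB⟩
  obtain ⟨A', B'⟩ := p
  obtain ⟨h1, h2, h3, h4, h5, h6, h7⟩ := hp.prop
  simp only at h1 h2 h3 h4 h5 h6 h7
  have hcov : U ⊆ A' ∪ B' := by
    refine hU.2 _ (Set.union_subset h3 h4) (h6.1.mono Set.subset_union_left) ?_
    intro x hx y hy hxy
    by_contra hn
    simp only [Set.mem_union, not_or] at hn
    rcases hx with hx | hx
    · have := hp.le_of_ge (y := (insert y A', B')) ⟨h1.trans (Set.subset_insert _ _), h2,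
        Set.insert_subset hy h3, h4, Set.disjoint_insert_left.2 ⟨hn.2, h5⟩, h6.insert hx hxy, h7⟩
        ⟨Set.subset_insert _ _, le_rfl⟩
      exact hn.1 (this.1 (Set.mem_insert _ _))
    · have := hp.le_of_ge (y := (A', insert y B')) ⟨h1, h2.trans (Set.subset_insert _ _), h3,
        Set.insert_subset hy h4, Set.disjoint_insert_right.2 ⟨hn.1, h5⟩, h6, h7.insert hx hxy⟩
        ⟨le_rfl, Set.subset_insert _ _⟩
      exact hn.2 (this.2 (Set.mem_insert _ _))
  have hB' : U \ A' = B' := by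
    ext z
    constructor
    · rintro ⟨hz, hzA⟩
      exact (hcov hz).resolve_left hzA
    · intro hz
      exact ⟨h4 hz, fun hzA => Set.disjoint_left.1 h5 hzA hz⟩
  exact ⟨A', h1, h3, hB' ▸ h2, h6, hB' ▸ h7⟩

/-- Either a connected set meets both `L₁` and `L₂`, or they can be separated. -/
theorem menger_one {V : Type*} [Finite V] (G : SimpleGraph V) (U L₁ L₂ : Set V) :
    (∃ K ⊆ U, CC G K ∧ (K ∩ L₁).Nonempty ∧ (K ∩ L₂).Nonempty) ∨
    (∃ P ⊆ U, L₁ ∩ U ⊆ P ∧ Disjoint P L₂ ∧ ∀ x ∈ P, ∀ y ∈ U, G.Adj x y → y ∈ P) := by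
  by_cases h : ∃ K ⊆ U, CC G K ∧ (K ∩ L₁).Nonempty ∧ (K ∩ L₂).Nonempty
  · exact Or.inl h
  · right
    refine ⟨⋃₀ {K | K ⊆ U ∧ CC G K ∧ (K ∩ L₁).Nonempty}, ?_, ?_, ?_, ?_⟩
    · exact Set.sUnion_subset fun K hK => hK.1
    · rintro l ⟨hl1, hlU⟩
      exact ⟨{l}, ⟨Set.singleton_subset_iff.2 hlU, CC.singleton G l, l, rfl, hl1⟩, rfl⟩
    · rw [Set.disjoint_left]
      rintro x ⟨K, hK, hx⟩ hx2
      exact h ⟨K, hK.1, hK.2.1, hK.2.2, x, hx, hx2⟩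
    · rintro x ⟨K, hK, hx⟩ y hy hxy
      exact ⟨insert y K, ⟨Set.insert_subset hy hK.1, hK.2.1.insert hx hxy,
        hK.2.2.mono (Set.inter_subset_inter_left _ (Set.subset_insert _ _))⟩, Set.mem_insert _ _⟩

theorem menger_two_aux {V : Type*} [Finite V] [Nonempty V] (G : SimpleGraph V) (n : ℕ) :
    ∀ U L₁ L₂ : Set V, U.ncard = n →
    (∃ A B, A ⊆ U ∧ B ⊆ U ∧ Disjoint A B ∧ CC G A ∧ CC G B ∧ (A ∩ L₁).Nonempty ∧
      (A ∩ L₂).Nonempty ∧ (B ∩ L₁).Nonempty ∧ (B ∩ L₂).Nonempty) ∨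
    (∃ s, ∃ P ⊆ U \ {s}, L₁ ∩ (U \ {s}) ⊆ P ∧ Disjoint P L₂ ∧
      ∀ x ∈ P, ∀ y ∈ U \ {s}, G.Adj x y → y ∈ P) := by
  induction n with
  | zero =>
    intro U L₁ L₂ hU
    right
    have : U = ∅ := (Set.ncard_eq_zero).1 hU
    subst this
    exact ⟨Classical.arbitrary V, ∅, by simp, by simp, by simp, by simp⟩
  | succ n ih =>
    intro U L₁ L₂ hU
    by_cases hL : (U ∩ L₁ ∩ L₂).Nonempty
    · obtain ⟨v, ⟨hvU, hv1⟩, hv2⟩ := hL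
      rcases menger_one G (U \ {v}) L₁ L₂ with ⟨K, hK, hc, h1, h2⟩ | ⟨P, hP⟩
      · left
        refine ⟨{v}, K, by simpa using hvU, hK.trans Set.sdiff_subset, ?_, CC.singleton G v, hc,
          ⟨v, rfl, hv1⟩, ⟨v, rfl, hv2⟩, h1, h2⟩
        rw [Set.disjoint_singleton_left]
        exact fun h => (hK h).2 rfl
      · exact Or.inr ⟨v, P, hP⟩
    by_cases hL1 : (U ∩ L₁).Nonempty
    swap
    · right
      refine ⟨Classical.arbitrary V, ∅, by simp, ?_, by simp, by simp⟩
      rintro x ⟨hx1, hx2⟩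
      exact hL1 ⟨x, hx2.1, hx1⟩
    obtain ⟨v, hvU, hv1⟩ := hL1
    have hv2 : v ∉ L₂ := fun h => hL ⟨v, ⟨hvU, hv1⟩, h⟩
    have hcard : (U \ {v}).ncard = n := by
      rw [Set.ncard_sdiff_singleton_of_mem hvU, hU]; rfl
    rcases ih (U \ {v}) (L₁ ∪ G.neighborSet v) L₂ hcard with
      ⟨A, B, hAU, hBU, hd, hA, hB, hA1, hA2, hB1, hB2⟩ | ⟨s, P, hP, hP1, hP2, hP3⟩
    · have hvA : v ∉ A := fun h => (hAU h).2 rfl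
      have hvB : v ∉ B := fun h => (hBU h).2 rfl
      have hAU' := hAU.trans Set.sdiff_subset
      have hBU' := hBU.trans Set.sdiff_subset
      have aux : ∀ A B : Set V, A ⊆ U → B ⊆ U → v ∉ A → v ∉ B → Disjoint A B → CC G A → CC G B →
          (A ∩ L₁).Nonempty → (A ∩ L₂).Nonempty → (B ∩ G.neighborSet v).Nonempty →
          (B ∩ L₂).Nonempty → 
          (∃ A B, A ⊆ U ∧ B ⊆ U ∧ Disjoint A B ∧ CC G A ∧ CC G B ∧ (A ∩ L₁).Nonempty ∧
            (A ∩ L₂).Nonempty ∧ (B ∩ L₁).Nonempty ∧ (B ∩ L₂).Nonempty) := by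
        intro A B hA hB hvA hvB hd cA cB h1 h2 h3 h4
        obtain ⟨b, hb, hbv⟩ := h3
        refine ⟨A, insert v B, hA, Set.insert_subset hvU hB,
          Set.disjoint_insert_right.2 ⟨hvA, hd⟩, cA, cB.insert hb (SimpleGraph.Adj.symm hbv), h1, h2,
          ⟨v, Set.mem_insert _ _, hv1⟩, h4.mono ?_⟩
        exact Set.inter_subset_inter_left _ (Set.subset_insert _ _)
      by_cases hAL : (A ∩ L₁).Nonempty
      · by_cases hBL : (B ∩ L₁).Nonempty
        · exact Or.inl ⟨A, B, hAU', hBU', hd, hA, hB, hAL, hA2, hBL, hB2⟩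
        · left
          refine aux A B hAU' hBU' hvA hvB hd hA hB hAL hA2 ?_ hB2
          obtain ⟨b, hb, hb'⟩ := hB1
          exact ⟨b, hb, hb'.resolve_left fun h => hBL ⟨b, hb, h⟩⟩
      have hAN : (A ∩ G.neighborSet v).Nonempty := by
        obtain ⟨b, hb, hb'⟩ := hA1
        exact ⟨b, hb, hb'.resolve_left fun h => hAL ⟨b, hb, h⟩⟩
      by_cases hBL : (B ∩ L₁).Nonempty
      · exact Or.inl (aux B A hBU' hAU' hvB hvA hd.symm hB hA hBL hB2 hAN hA2)
      have hBN : (B ∩ G.neighborSet v).Nonempty := by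
        obtain ⟨b, hb, hb'⟩ := hB1
        exact ⟨b, hb, hb'.resolve_left fun h => hBL ⟨b, hb, h⟩⟩
      rcases menger_one G (U \ {v}) L₁ L₂ with ⟨K, hK, hc, h1, h2⟩ | ⟨P, hP⟩
      swap
      · exact Or.inr ⟨v, P, hP⟩
      left
      obtain ⟨l, hlK, hl1⟩ := h1
      have hlU : l ∈ (U \ {v}) \ (A ∪ B) := by
        refine ⟨hK hlK, ?_⟩
        rintro (h | h)
        · exact hAL ⟨l, h, hl1⟩
        · exact hBL ⟨l, h, hl1⟩
      obtain ⟨D, hDU, hlD, hD, hDcl⟩ := exists_component G _ l hlU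
      have hDU' : D ⊆ U := fun x hx => (hDU hx).1.1
      have hvD : v ∉ D := fun h => (hDU h).1.2 rfl
      have hDA : Disjoint D A := Set.disjoint_left.2 fun x hx h => (hDU hx).2 (Or.inl h)
      have hDB : Disjoint D B := Set.disjoint_left.2 fun x hx h => (hDU hx).2 (Or.inr h)
      by_cases hDL : (D ∩ L₂).Nonempty
      · exact aux D A hDU' hAU' hvD hvA hDA hD hA ⟨l, hlD, hl1⟩ hDL hAN hA2
      by_cases hadj : ∃ x ∈ D, ∃ y ∈ A ∪ B, G.Adj x y
      · obtain ⟨x, hx, y, hy | hy, hxy⟩ := hadj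
        · refine aux (D ∪ A) B (Set.union_subset hDU' hAU') hBU' (by simp [hvD, hvA]) hvB
            (Set.disjoint_union_left.2 ⟨hDB, hd⟩) (hD.union hA hx hy hxy) hB
            ⟨l, Or.inl hlD, hl1⟩ (hA2.mono ?_) hBN hB2
          exact Set.inter_subset_inter_left _ Set.subset_union_right
        · refine aux (D ∪ B) A (Set.union_subset hDU' hBU') hAU' (by simp [hvD, hvB]) hvA
            (Set.disjoint_union_left.2 ⟨hDA, hd.symm⟩) (hD.union hB hx hy hxy) hA
            ⟨l, Or.inl hlD, hl1⟩ (hB2.mono ?_) hAN hA2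
          exact Set.inter_subset_inter_left _ Set.subset_union_right
      · exfalso
        have := hc.2 (K ∩ D) Set.inter_subset_left ⟨l, hlK, hlD⟩ (by
          rintro x ⟨hxK, hxD⟩ y hy hxy
          refine ⟨hy, hDcl x hxD y ⟨hK hy, fun h => hadj ⟨x, hxD, y, h, hxy⟩⟩ hxy⟩)
        obtain ⟨z, hz, hz2⟩ := h2
        exact hDL ⟨z, (this hz).2, hz2⟩
    · right
      by_cases hsv : s = v
      · subst hsv
        refine ⟨s, P, fun x hx => (hP hx).1, ?_, hP2, ?_⟩
        · rintro x ⟨hx1, hx2⟩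
          exact hP1 ⟨Or.inl hx1, hx2, hx2.2⟩
        · intro x hx y hy hxy
          exact hP3 x hx y ⟨hy, hy.2⟩ hxy
      · refine ⟨s, insert v P, ?_, ?_, ?_, ?_⟩
        · refine Set.insert_subset ⟨hvU, fun h => hsv h.symm⟩ ?_
          exact fun x hx => ⟨(hP hx).1.1, (hP hx).2⟩
        · rintro x ⟨hx1, hx2⟩
          by_cases hxv : x = v
          · exact Or.inl hxv
          · exact Or.inr (hP1 ⟨Or.inl hx1, ⟨hx2.1, hxv⟩, hx2.2⟩)
        · exact Set.disjoint_insert_left.2 ⟨hv2, hP2⟩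
        · intro x hx y hy hxy
          by_cases hyv : y = v
          · exact Or.inl hyv
          right
          rcases hx with rfl | hx
          · exact hP1 ⟨Or.inr hxy, ⟨hy.1, hyv⟩, hy.2⟩
          · exact hP3 x hx y ⟨⟨hy.1, hyv⟩, hy.2⟩ hxy

/-- Menger's theorem for two paths, in partition form. -/
theorem menger_two {V : Type*} [Finite V] {G : SimpleGraph V} {U : Set V} (hU : CC G U)
    (L₁ L₂ : Set V) :
    (∃ A ⊆ U, CC G A ∧ CC G (U \ A) ∧ (A ∩ L₁).Nonempty ∧
      (A ∩ L₂).Nonempty ∧ ((U \ A) ∩ L₁).Nonempty ∧ ((U \ A) ∩ L₂).Nonempty) ∨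
    (∃ s ∈ U, ∃ P ⊆ U \ {s}, L₁ ∩ (U \ {s}) ⊆ P ∧ Disjoint P L₂ ∧
      ∀ x ∈ P, ∀ y ∈ U \ {s}, G.Adj x y → y ∈ P) := by
  obtain ⟨u, hu⟩ := hU.1
  have : Nonempty V := ⟨u⟩
  rcases menger_two_aux G _ U L₁ L₂ rfl with
    ⟨A, B, hAU, hBU, hd, hA, hB, hA1, hA2, hB1, hB2⟩ | ⟨s, P, hP, hP1, hP2, hP3⟩
  · left
    obtain ⟨A', h1, h2, h3, h4, h5⟩ := extend_partition hU hA hB hAU hBU hd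
    exact ⟨A', h2, h4, h5, hA1.mono (Set.inter_subset_inter_left _ h1),
      hA2.mono (Set.inter_subset_inter_left _ h1), hB1.mono (Set.inter_subset_inter_left _ h3),
      hB2.mono (Set.inter_subset_inter_left _ h3)⟩
  · right
    by_cases hs : s ∈ U
    · exact ⟨s, hs, P, hP, hP1, hP2, hP3⟩
    · have hUs : U \ {s} = U := Set.sdiff_singleton_eq_self hs
      rw [hUs] at hP hP1 hP3
      refine ⟨u, hu, P \ {u}, Set.sdiff_subset_sdiff_left hP, ?_, hP2.mono_left Set.sdiff_subset, ?_⟩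
      · rintro x ⟨hx1, hx2⟩
        exact ⟨hP1 ⟨hx1, hx2.1⟩, hx2.2⟩
      · intro x hx y hy hxy
        exact ⟨hP3 x hx.1 y hy.1 hxy, hy.2⟩

/-! ### Models of contraction minors -/

/-- `f` exhibits `D` as the quotient of `C` by connected fibres. -/
structure Model {V W : Type} (G : SimpleGraph V) (X : Set (Sym2 V)) (H : SimpleGraph W)
    (Y : Set (Sym2 W)) (f : V → W) : Prop where
  surj : Function.Surjective f
  fib : ∀ d, PC G (f ⁻¹' {d})
  adj : ∀ a b, a ≠ b → (H.Adj a b ↔ ∃ x y, f x = a ∧ f y = b ∧ G.Adj x y)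
  bond : ∀ x y, s(x, y) ∈ X ↔ G.Adj x y ∧ s(f x, f y) ∈ Y

theorem contractFun_val {V : Type*} {u v : V} (huv : u ≠ v) (w : {w : V // w ≠ v}) :
    contractFun huv w.1 = w := by
  simp [contractFun, w.2]

theorem contractFun_f {V W : Type*} {u v : V} (huv : u ≠ v) (f : V → W) (hf : f u = f v) (x : V) :
    f (contractFun huv x).1 = f x := by
  unfold contractFun
  by_cases h : x = v
  · simp [h, hf]
  · simp [h]

theorem contract_adj {V : Type*} (G : SimpleGraph V) {u v : V} (huv : u ≠ v)
    (p q : {w : V // w ≠ v}) : (contractGraph G huv).Adj p q ↔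
      p ≠ q ∧ ∃ x y, G.Adj x y ∧ contractFun huv x = p ∧ contractFun huv y = q := by
  rw [contractGraph, fromEdgeSet_adj, and_comm]
  refine and_congr_right fun _ => ?_
  constructor
  · rintro ⟨e, he, h⟩
    induction e using Sym2.ind with
    | _ x y =>
      rw [Sym2.map_mk, Sym2.eq_iff] at h
      rcases h with ⟨h1, h2⟩ | ⟨h1, h2⟩
      · exact ⟨x, y, he, h1, h2⟩
      · exact ⟨y, x, SimpleGraph.Adj.symm he, h2, h1⟩
  · rintro ⟨x, y, h, rfl, rfl⟩
    exact ⟨s(x, y), h, rfl⟩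

theorem Model.contract {V W : Type} {G : SimpleGraph V} {E : Set (Sym2 V)} {H : SimpleGraph W}
    {Y : Set (Sym2 W)} {f : V → W} (hM : Model G E H Y f) {u v : V} (h : G.Adj u v) (hf : f u = f v) :
    Model (contractGraph G h.ne)
      {e | e ∈ Sym2.map (contractFun h.ne) '' E ∧ ¬ e.IsDiag} H Y
      (fun w : {w : V // w ≠ v} => f w.1) := by
  have hcf := contractFun_f h.ne f hf
  refine ⟨?_, ?_, ?_, ?_⟩
  · intro d
    obtain ⟨x, hx⟩ := hM.surj d
    exact ⟨contractFun h.ne x, (hcf x).trans hx⟩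
  · intro d X hX hne hcl w hw
    have := hM.fib d {x | contractFun h.ne x ∈ X}
      (by intro x hx
          have := hX hx
          exact (hcf x).symm.trans this)
      (by obtain ⟨x, hx⟩ := hne
          exact ⟨x.1, by rw [Set.mem_ofPred_eq, contractFun_val]; exact hx⟩)
      (by intro x hx y hy hxy
          by_cases he : contractFun h.ne x = contractFun h.ne y
          · rw [Set.mem_ofPred_eq, ← he]; exact hx
          · refine hcl _ hx _ ((hcf y).trans hy) ?_
            exact (contract_adj G h.ne _ _).2 ⟨he, x, y, hxy, rfl, rfl⟩)
    have h2 := this (show w.1 ∈ _ from hw)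
    rw [Set.mem_ofPred_eq, contractFun_val] at h2
    exact h2
  · intro a b hab
    rw [hM.adj a b hab]
    constructor
    · rintro ⟨x, y, hx, hy, hxy⟩
      refine ⟨contractFun h.ne x, contractFun h.ne y, (hcf x).trans hx, (hcf y).trans hy, ?_⟩
      refine (contract_adj G h.ne _ _).2 ⟨?_, x, y, hxy, rfl, rfl⟩
      intro he
      apply hab
      rw [← hx, ← hy, ← hcf x, ← hcf y, he]
    · rintro ⟨p, q, hp, hq, hpq⟩
      obtain ⟨_, x, y, hxy, rfl, rfl⟩ := (contract_adj G h.ne _ _).1 hpq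
      exact ⟨x, y, (hcf x).symm.trans hp, (hcf y).symm.trans hq, hxy⟩
  · intro p q
    constructor
    · rintro ⟨⟨e, he, hpq⟩, hdiag⟩
      rw [Sym2.mk_isDiag_iff] at hdiag
      induction e using Sym2.ind with
      | _ x y =>
        obtain ⟨hxy, hX⟩ := (hM.bond x y).1 he
        rw [Sym2.map_mk, Sym2.eq_iff] at hpq
        rcases hpq with ⟨rfl, rfl⟩ | ⟨rfl, rfl⟩
        · refine ⟨(contract_adj G h.ne _ _).2 ⟨hdiag, x, y, hxy, rfl, rfl⟩, ?_⟩
          rw [hcf, hcf]; exact hX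
        · refine ⟨(contract_adj G h.ne _ _).2 ⟨hdiag, y, x, hxy.symm, rfl, rfl⟩, ?_⟩
          rw [hcf, hcf, Sym2.eq_swap]; exact hX
    · rintro ⟨hadj, hX⟩
      obtain ⟨hne, x, y, hxy, rfl, rfl⟩ := (contract_adj G h.ne _ _).1 hadj
      rw [hcf, hcf] at hX
      refine ⟨⟨s(x, y), (hM.bond x y).2 ⟨hxy, hX⟩, rfl⟩, ?_⟩
      rw [Sym2.mk_isDiag_iff]
      exact hne

theorem Model.iso {C D : CGraph} {f : C.V → D.V} (hM : Model C.G C.X D.G D.X f) (hD : D.WF)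
    (hf : Function.Injective f) : CGIso C D := by
  have hadj : ∀ x y, D.G.Adj (f x) (f y) ↔ C.G.Adj x y := by
    intro x y
    constructor
    · intro h
      obtain ⟨x', y', hx, hy, hxy⟩ := (hM.adj _ _ h.ne).1 h
      rwa [← hf hx, ← hf hy]
    · intro h
      exact (hM.adj _ _ (fun e => h.ne (hf e))).2 ⟨x, y, rfl, rfl, h⟩
  refine ⟨⟨Equiv.ofBijective f ⟨hf, hM.surj⟩, fun {x y} => hadj x y⟩, ?_⟩
  ext e
  constructor
  · rintro ⟨e', he', rfl⟩
    induction e' using Sym2.ind with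
    | _ x y => exact ((hM.bond x y).1 he').2
  · intro he
    induction e using Sym2.ind with
    | _ a b =>
      obtain ⟨x, rfl⟩ := hM.surj a
      obtain ⟨y, rfl⟩ := hM.surj b
      exact ⟨s(x, y), (hM.bond x y).2 ⟨(hadj x y).1 (hD he), he⟩, rfl⟩

theorem Model.minor (D : CGraph) (hD : D.WF) (n : ℕ) : ∀ (C : CGraph) (f : C.V → D.V),
    Nat.card C.V = n → Model C.G C.X D.G D.X f → ∃ C', IsSCMinor C C' ∧ CGIso C' D := by
  induction n with
  | zero =>
    intro C f hn hM
    refine ⟨C, Relation.ReflTransGen.refl, hM.iso hD ?_⟩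
    rcases Nat.card_eq_zero.1 hn with h | h
    · exact fun x => (h.false x).elim
    · exact (h.not_finite C.fin).elim
  | succ n ih =>
    intro C f hn hM
    by_cases hf : Function.Injective f
    · exact ⟨C, Relation.ReflTransGen.refl, hM.iso hD hf⟩
    · simp only [Function.Injective, not_forall] at hf
      obtain ⟨x, y, hxy, hne⟩ := hf
      have : ∃ v, C.G.Adj x v ∧ f x = f v := by
        by_contra hcon
        push Not at hcon
        have := hM.fib (f x) {x} (by simp) ⟨x, rfl⟩ (by
          rintro a rfl b hb hab
          exact (hcon b hab hb.symm).elim)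
        exact hne (this (show y ∈ f ⁻¹' {f x} from hxy.symm)).symm
      obtain ⟨v, hadj, hfv⟩ := this
      have hX : s(x, v) ∉ C.X := by
        intro h
        have h2 := hD ((hM.bond x v).1 h).2
        rw [hfv] at h2
        exact (D.G.irrefl h2)
      have hcard : Nat.card (C.contract x v hadj.ne).V = n := by
        have h1 : Nat.card {w : C.V // w ≠ v} = ({v}ᶜ : Set C.V).ncard := by
          rw [← Nat.card_coe_set_eq]; rfl
        have h2 := Set.ncard_add_ncard_compl ({v} : Set C.V)
        rw [Set.ncard_singleton] at h2
        change Nat.card {w : C.V // w ≠ v} = n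
        omega
      obtain ⟨C', h1, h2⟩ := ih _ _ hcard (hM.contract hadj hfv)
      exact ⟨C', Relation.ReflTransGen.head (SCMStep.contr C x v hadj hX) h1, h2⟩

theorem Model.conclude {C D : CGraph} {f : C.V → D.V} (hM : Model C.G C.X D.G D.X f) (hD : D.WF)
    (hgood : ∀ C', CGIso C' D → GoodAlong C') (hirr : BondIrreducible C) : CGIso C D := by
  obtain ⟨C', h1, h2⟩ := Model.minor D hD _ C f rfl hM
  rcases Relation.reflTransGen_iff_eq_or_transGen.1 h1 with rfl | h
  · exact h2
  · exact (hirr.2 ⟨C', h, hgood C' h2⟩).elim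

/-! ### The main combinatorial argument -/

/-- `A` and `B` are joined by an edge. -/
def Touch {V : Type*} (G : SimpleGraph V) (A B : Set V) : Prop := ∃ a ∈ A, ∃ b ∈ B, G.Adj a b

theorem Touch.symm {V : Type*} {G : SimpleGraph V} {A B : Set V} (h : Touch G A B) :
    Touch G B A := by
  obtain ⟨a, ha, b, hb, hab⟩ := h
  exact ⟨b, hb, a, ha, hab.symm⟩

/-- A proper nonempty part of a connected set touches the rest. -/
theorem PC.touch {V : Type*} {G : SimpleGraph V} {U A : Set V} (hU : PC G U) (hA : A ⊆ U)
    (hne : A.Nonempty) (hne' : (U \ A).Nonempty) : Touch G A (U \ A) := by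
  by_contra hcon
  obtain ⟨z, hz, hzA⟩ := hne'
  refine hzA (hU A hA hne ?_ hz)
  intro x hx y hy hxy
  by_contra hyA
  exact hcon ⟨x, hx, y, ⟨hy, hyA⟩, hxy⟩

/-- Three-connectedness along the bond between `S` and `T`, in terms of cuts. -/
structure Setup {V : Type*} (G : SimpleGraph V) (S T : Set V) : Prop where
  cover : ∀ v, v ∈ S ∨ v ∈ T
  disj : ∀ v, v ∈ S → v ∈ T → False
  cS : CC G S
  cT : CC G T
  c0 : PC G Set.univ
  c1 : ∀ x, PC G {x}ᶜ
  c2 : ∀ x ∈ S, ∀ y ∈ T, PC G {x, y}ᶜ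
  ntS : S.Nontrivial
  ntT : T.Nontrivial

theorem Setup.symm {V : Type*} {G : SimpleGraph V} {S T : Set V} (h : Setup G S T) :
    Setup G T S :=
  ⟨fun v => (h.cover v).symm, fun v a b => h.disj v b a, h.cT, h.cS, h.c0, h.c1,
    fun x hx y hy => by rw [Set.pair_comm]; exact h.c2 y hy x hx, h.ntT, h.ntS⟩

/-- A model of the special `K₄`. -/
def K4M {V : Type*} (G : SimpleGraph V) (S T : Set V) : Prop :=
  ∃ A ⊆ S, ∃ B ⊆ T, CC G A ∧ CC G (S \ A) ∧ CC G B ∧ CC G (T \ B) ∧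
    Touch G A B ∧ Touch G A (T \ B) ∧ Touch G (S \ A) B ∧ Touch G (S \ A) (T \ B)

theorem K4M.symm {V : Type*} {G : SimpleGraph V} {S T : Set V} (h : K4M G S T) : K4M G T S := by
  obtain ⟨A, hA, B, hB, h1, h2, h3, h4, h5, h6, h7, h8⟩ := h
  exact ⟨B, hB, A, hA, h3, h4, h1, h2, h5.symm, h7.symm, h6.symm, h8.symm⟩

theorem key {V : Type*} [Finite V] {G : SimpleGraph V} {S T : Set V} (h : Setup G S T)
    (hK : ¬ K4M G S T) (y : V) (hy : y ∈ T) :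
    CC G (T \ {y}) ∧ ∃ s, ∀ x ∈ S, G.Adj x y → x = s := by
  obtain ⟨l, hl, hly⟩ := h.ntT.exists_ne y
  obtain ⟨K, hKU, hlK, hKc, hKcl⟩ := exists_component G (T \ {y}) l ⟨hl, hly⟩
  have hKT : K ⊆ T := hKU.trans Set.sdiff_subset
  have hyK : y ∉ K := fun h => (hKU h).2 rfl
  -- the complement of the component is connected
  have hB : CC G (T \ K) := by
    refine ⟨⟨y, hy, hyK⟩, ?_⟩
    have aux : ∀ Y ⊆ T \ K, Y.Nonempty → y ∉ Y →
        (∀ a ∈ Y, ∀ b ∈ T \ K, G.Adj a b → b ∈ Y) → False := by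
      intro Y hY hne hyY hcl
      have := h.cT.2 Y (fun a ha => (hY ha).1) hne (by
        intro a ha b hb hab
        by_cases hbK : b ∈ K
        · exfalso
          refine (hY ha).2 (hKcl b hbK a ⟨(hY ha).1, ?_⟩ hab.symm)
          rintro rfl
          exact hyY ha
        · exact hcl a ha b ⟨hb, hbK⟩ hab)
      exact hyY (this hy)
    intro X hX hne hcl z hz
    by_contra hzX
    by_cases hyX : y ∈ X
    · refine aux ((T \ K) \ X) Set.sdiff_subset ⟨z, hz, hzX⟩ (fun h => h.2 hyX) ?_
      intro a ha b hb hab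
      exact ⟨hb, fun hbX => ha.2 (hcl b hbX a ha.1 hab.symm)⟩
    · exact aux X hX hne hyX hcl
  rcases menger_two h.cS {x | ∃ b ∈ T \ K, G.Adj x b} {x | ∃ b ∈ K, G.Adj x b} with
    ⟨A, hAS, hA, hA', ⟨a1, ha1, b1, hb1, h1⟩, ⟨a2, ha2, b2, hb2, h2⟩, ⟨a3, ha3, b3, hb3, h3⟩,
      ⟨a4, ha4, b4, hb4, h4⟩⟩ | ⟨s, hs, P, hP, hP1, hP2, hP3⟩
  · exact (hK ⟨A, hAS, K, hKT, hA, hA', hKc, hB, ⟨a2, ha2, b2, hb2, h2⟩, ⟨a1, ha1, b1, hb1, h1⟩,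
      ⟨a4, ha4, b4, hb4, h4⟩, ⟨a3, ha3, b3, hb3, h3⟩⟩).elim
  have hlS : l ∉ S := fun h' => h.disj _ h' hl
  have hsT : s ∉ T := fun h' => h.disj _ hs h'
  have hyS : y ∉ S := fun h' => h.disj _ h' hy
  have hcut := h.c2 s hs y hy (K ∪ ((S \ {s}) \ P)) (by
      rintro x (hx | hx)
      · have hxT := hKT hx
        simp only [Set.mem_compl_iff, Set.mem_insert_iff, Set.mem_singleton_iff, not_or]
        refine ⟨?_, ?_⟩
        · rintro rfl; exact hsT hxT
        · rintro rfl; exact hyK hx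
      · simp only [Set.mem_compl_iff, Set.mem_insert_iff, Set.mem_singleton_iff, not_or]
        refine ⟨hx.1.2, ?_⟩
        rintro rfl; exact hyS hx.1.1) ⟨l, Or.inl hlK⟩ (by
      intro x hx z hz hxz
      simp only [Set.mem_compl_iff, Set.mem_insert_iff, Set.mem_singleton_iff, not_or] at hz
      rcases h.cover z with hzS | hzT
      · right
        refine ⟨⟨hzS, hz.1⟩, fun hzP => ?_⟩
        rcases hx with hx | hx
        · exact Set.disjoint_left.1 hP2 hzP ⟨x, hx, hxz.symm⟩
        · exact hx.2 (hP3 z hzP x hx.1 hxz.symm)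
      · left
        rcases hx with hx | hx
        · exact hKcl x hx z ⟨hzT, hz.2⟩ hxz
        · by_contra hzK
          exact hx.2 (hP1 ⟨⟨z, ⟨hzT, hzK⟩, hxz⟩, hx.1⟩))
  have hKeq : K = T \ {y} := by
    refine Set.Subset.antisymm hKU ?_
    rintro z ⟨hzT, hzy⟩
    have hz : z ∈ ({s, y} : Set V)ᶜ := by
      simp only [Set.mem_compl_iff, Set.mem_insert_iff, Set.mem_singleton_iff, not_or]
      exact ⟨fun e => hsT (e ▸ hzT), hzy⟩
    rcases hcut hz with h' | h'
    · exact h'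
    · exact (h.disj z h'.1.1 hzT).elim
  refine ⟨hKeq ▸ hKc, s, ?_⟩
  intro x hx hxy
  by_contra hxs
  have hxP : x ∈ P := hP1 ⟨⟨y, ⟨hy, hyK⟩, hxy⟩, hx, hxs⟩
  have hz : x ∈ ({s, y} : Set V)ᶜ := by
    simp only [Set.mem_compl_iff, Set.mem_insert_iff, Set.mem_singleton_iff, not_or]
    exact ⟨hxs, fun e => hyS (e ▸ hx)⟩
  rcases hcut hz with h' | h'
  · exact h.disj x hx (hKT h')
  · exact h'.2 hxP

/-- Rooted triangle minors in two-connected graphs. -/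
theorem rooted_triangle {V : Type*} [Finite V] {G : SimpleGraph V} {S : Set V}
    (hS1 : ∀ x ∈ S, CC G (S \ {x})) (a : Fin 3 → V) (ha : ∀ i, a i ∈ S)
    (hinj : Function.Injective a) :
    ∃ g : V → Fin 3, (∀ i, g (a i) = i) ∧ (∀ i, CC G {x | x ∈ S ∧ g x = i}) ∧
      (∀ i, CC G {x | x ∈ S ∧ g x ≠ i}) ∧
      ∀ i j, i ≠ j → Touch G {x | x ∈ S ∧ g x = i} {x | x ∈ S ∧ g x = j} := by
  classical
  have h01 : a 0 ≠ a 1 := fun e => absurd (hinj e) (by decide)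
  have h02 : a 0 ≠ a 2 := fun e => absurd (hinj e) (by decide)
  have h12 : a 1 ≠ a 2 := fun e => absurd (hinj e) (by decide)
  have hmain : ∃ A ⊆ S \ {a 2}, CC G A ∧ CC G ((S \ {a 2}) \ A) ∧ a 0 ∈ A ∧
      a 1 ∈ (S \ {a 2}) \ A ∧ Touch G {a 2} A ∧ Touch G {a 2} ((S \ {a 2}) \ A) := by
    rcases menger_two (hS1 _ (ha 2)) (G.neighborSet (a 2)) {a 0, a 1} with
      ⟨A, hAS, hA, hA', ⟨x1, hx1, hx1'⟩, ⟨x2, hx2, hx2'⟩, ⟨x3, hx3, hx3'⟩, ⟨x4, hx4, hx4'⟩⟩ |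
      ⟨s, hs, P, hP, hP1, hP2, hP3⟩
    · have t1 : Touch G {a 2} A := ⟨_, rfl, x1, hx1, hx1'⟩
      have t2 : Touch G {a 2} ((S \ {a 2}) \ A) := ⟨_, rfl, x3, hx3, hx3'⟩
      rcases hx2' with rfl | hx2'
      · refine ⟨A, hAS, hA, hA', hx2, ?_, t1, t2⟩
        rcases hx4' with rfl | hx4'
        · exact (hx4.2 hx2).elim
        · rw [Set.mem_singleton_iff] at hx4'
          exact hx4' ▸ hx4
      · rw [Set.mem_singleton_iff] at hx2'
        subst hx2'
        have hx40 : x4 = a 0 := by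
          rcases hx4' with hx4' | hx4'
          · exact hx4'
          · rw [Set.mem_singleton_iff] at hx4'
            exact (hx4.2 (hx4' ▸ hx2)).elim
        have he : (S \ {a 2}) \ ((S \ {a 2}) \ A) = A := by
          rw [Set.sdiff_sdiff_cancel_left hAS]
        exact ⟨(S \ {a 2}) \ A, Set.sdiff_subset, hA', he.symm ▸ hA, hx40 ▸ hx4,
          he.symm ▸ hx2, t2, he.symm ▸ t1⟩
    · exfalso
      have hs2 : s ≠ a 2 := hs.2
      -- one of the two roots is not `s`
      obtain ⟨r, hrS, hrs, hr2, hrL⟩ : ∃ r ∈ S, r ≠ s ∧ r ≠ a 2 ∧ r ∈ ({a 0, a 1} : Set V) := by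
        by_cases e : a 0 = s
        · exact ⟨a 1, ha 1, fun e' => h01 (e.trans e'.symm), h12, by simp⟩
        · exact ⟨a 0, ha 0, e, h02, by simp⟩
      have hrP : r ∉ P := fun h' => Set.disjoint_left.1 hP2 h' hrL
      have := (hS1 s hs.1).2 (insert (a 2) P) (by
          refine Set.insert_subset ⟨ha 2, fun e => hs2 e.symm⟩ ?_
          exact fun x hx => ⟨(hP hx).1.1, (hP hx).2⟩) ⟨a 2, Set.mem_insert _ _⟩ (by
          intro x hx y hy hxy
          by_cases hy2 : y = a 2
          · exact Or.inl hy2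
          right
          rcases hx with rfl | hx
          · exact hP1 ⟨hxy, ⟨hy.1, hy2⟩, hy.2⟩
          · exact hP3 x hx y ⟨⟨hy.1, hy2⟩, hy.2⟩ hxy)
      rcases this ⟨hrS, hrs⟩ with h' | h'
      · exact hr2 h'
      · exact hrP h'
  obtain ⟨A, hAS, hA, hA', h0, h1, t1, t2⟩ := hmain
  have t3 : Touch G A ((S \ {a 2}) \ A) := (hS1 _ (ha 2)).2.touch hAS hA.1 hA'.1
  have h2A : a 2 ∉ A := fun h => (hAS h).2 rfl
  let g : V → Fin 3 := fun x => if x = a 2 then 2 else if x ∈ A then 0 else 1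
  have e0 : {x | x ∈ S ∧ g x = 0} = A := by
    ext x
    simp only [Set.mem_ofPred_eq, g]
    by_cases hx2 : x = a 2
    · subst hx2; simp [h2A]
    · by_cases hxA : x ∈ A
      · simp [hx2, hxA, (hAS hxA).1]
      · simp [hx2, hxA]
  have e1 : {x | x ∈ S ∧ g x = 1} = (S \ {a 2}) \ A := by
    ext x
    simp only [Set.mem_ofPred_eq, g]
    by_cases hx2 : x = a 2
    · subst hx2; simp
    · by_cases hxA : x ∈ A
      · simp [hx2, hxA]
      · simp [hx2, hxA]
  have e2 : {x | x ∈ S ∧ g x = 2} = {a 2} := by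
    ext x
    simp only [Set.mem_ofPred_eq, g]
    by_cases hx2 : x = a 2
    · subst hx2; simp [ha 2]
    · by_cases hxA : x ∈ A
      · simp [hx2, hxA]
      · simp [hx2, hxA]
  have hfib : ∀ i, CC G {x | x ∈ S ∧ g x = i} := by
    intro i
    fin_cases i
    · change CC G {x | x ∈ S ∧ g x = 0}
      rw [e0]; exact hA
    · change CC G {x | x ∈ S ∧ g x = 1}
      rw [e1]; exact hA'
    · change CC G {x | x ∈ S ∧ g x = 2}
      rw [e2]; exact CC.singleton G _
  have ht : ∀ i j, i ≠ j → Touch G {x | x ∈ S ∧ g x = i} {x | x ∈ S ∧ g x = j} := by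
    have h01 : Touch G {x | x ∈ S ∧ g x = 0} {x | x ∈ S ∧ g x = 1} := by rw [e0, e1]; exact t3
    have h20 : Touch G {x | x ∈ S ∧ g x = 2} {x | x ∈ S ∧ g x = 0} := by rw [e0, e2]; exact t1
    have h21 : Touch G {x | x ∈ S ∧ g x = 2} {x | x ∈ S ∧ g x = 1} := by rw [e1, e2]; exact t2
    intro i j hij
    fin_cases i <;> fin_cases j
    · exact (hij rfl).elim
    · exact h01
    · exact h20.symm
    · exact h01.symm
    · exact (hij rfl).elim
    · exact h21.symm
    · exact h20
    · exact h21
    · exact (hij rfl).elim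
  refine ⟨g, ?_, hfib, ?_, ht⟩
  · intro i
    fin_cases i
    · simp [g, h02, h0]
    · simp [g, h12, h1.2]
    · simp [g]
  · intro i
    have : ∃ j k : Fin 3, j ≠ k ∧ ∀ t : Fin 3, t ≠ i ↔ t = j ∨ t = k := by
      revert i; decide
    obtain ⟨j, k, hjk, hall⟩ := this
    have he : {x | x ∈ S ∧ g x ≠ i} = {x | x ∈ S ∧ g x = j} ∪ {x | x ∈ S ∧ g x = k} := by
      ext x
      simp only [Set.mem_ofPred_eq, Set.mem_union, hall]
      tauto
    obtain ⟨p, hp, q, hq, hpq⟩ := ht j k hjk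
    rw [he]
    exact (hfib j).union (hfib k) hp hq hpq

theorem inj3 {V : Type*} {x y z : V} (h1 : x ≠ y) (h2 : x ≠ z) (h3 : y ≠ z) :
    Function.Injective ![x, y, z] := by
  intro i j hij
  fin_cases i <;> fin_cases j
  · rfl
  · exact (h1 hij).elim
  · exact (h2 hij).elim
  · exact (h1 hij.symm).elim
  · rfl
  · exact (h3 hij).elim
  · exact (h2 hij.symm).elim
  · exact (h3 hij.symm).elim
  · rfl

/-- Three disjoint cross edges. -/
theorem three_edges {V : Type*} {G : SimpleGraph V} {S T : Set V} (h : Setup G S T)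
    (hT : ∀ y ∈ T, ∃ s, ∀ x ∈ S, G.Adj x y → x = s)
    (hS : ∀ x ∈ S, ∃ t, ∀ y ∈ T, G.Adj y x → y = t) :
    ∃ a b : Fin 3 → V, Function.Injective a ∧ Function.Injective b ∧ (∀ i, a i ∈ S) ∧
      (∀ i, b i ∈ T) ∧ ∀ i, G.Adj (a i) (b i) := by
  have uT : ∀ y ∈ T, ∀ x ∈ S, ∀ x' ∈ S, G.Adj x y → G.Adj x' y → x = x' := by
    intro y hy x hx x' hx' e e'
    obtain ⟨s, hs⟩ := hT y hy
    rw [hs x hx e, hs x' hx' e']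
  have uS : ∀ x ∈ S, ∀ y ∈ T, ∀ y' ∈ T, G.Adj x y → G.Adj x y' → y = y' := by
    intro x hx y hy y' hy' e e'
    obtain ⟨s, hs⟩ := hS x hx
    rw [hs y hy e.symm, hs y' hy' e'.symm]
  have edge : ∀ W : Set V, PC G W → (S ∩ W).Nonempty → (T ∩ W).Nonempty →
      ∃ x ∈ S ∩ W, ∃ y ∈ T ∩ W, G.Adj x y := by
    intro W hW h1 h2
    obtain ⟨t, ht, htW⟩ := h2
    obtain ⟨x, hx, y, hy, hxy⟩ := hW.touch (A := S ∩ W) Set.inter_subset_right h1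
      ⟨t, htW, fun h' => h.disj t h'.1 ht⟩
    refine ⟨x, hx, y, ⟨?_, hy.1⟩, hxy⟩
    exact (h.cover y).resolve_left fun h' => hy.2 ⟨h', hy.1⟩
  obtain ⟨s0, hs0⟩ := h.cS.1
  obtain ⟨t0, ht0⟩ := h.cT.1
  obtain ⟨a1, ⟨ha1, -⟩, b1, ⟨hb1, -⟩, e1⟩ := edge _ h.c0 ⟨s0, hs0, trivial⟩ ⟨t0, ht0, trivial⟩
  obtain ⟨s1, hs1, hs1'⟩ := h.ntS.exists_ne a1
  obtain ⟨a2, ⟨ha2, ha2'⟩, b2, ⟨hb2, -⟩, e2⟩ := edge _ (h.c1 a1) ⟨s1, hs1, hs1'⟩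
    ⟨b1, hb1, fun e => h.disj a1 ha1 (e ▸ hb1)⟩
  have ha21 : a2 ≠ a1 := ha2'
  have hb21 : b2 ≠ b1 := by
    rintro rfl
    exact ha21 (uT _ hb1 _ ha2 _ ha1 e2 e1)
  obtain ⟨a3, ⟨ha3, ha3'⟩, b3, ⟨hb3, hb3'⟩, e3⟩ := edge _ (h.c2 a1 ha1 b2 hb2)
    ⟨a2, ha2, by
      simp only [Set.mem_compl_iff, Set.mem_insert_iff, Set.mem_singleton_iff, not_or]
      exact ⟨ha21, fun e => h.disj a2 ha2 (e ▸ hb2)⟩⟩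
    ⟨b1, hb1, by
      simp only [Set.mem_compl_iff, Set.mem_insert_iff, Set.mem_singleton_iff, not_or]
      exact ⟨fun e => h.disj a1 ha1 (e ▸ hb1), hb21.symm⟩⟩
  simp only [Set.mem_compl_iff, Set.mem_insert_iff, Set.mem_singleton_iff, not_or] at ha3' hb3'
  have ha32 : a3 ≠ a2 := by
    rintro rfl
    exact hb3'.2 (uS _ ha3 _ hb3 _ hb2 e3 e2)
  have hb31 : b3 ≠ b1 := by
    rintro rfl
    exact ha3'.1 (uT _ hb3 _ ha3 _ ha1 e3 e1)
  refine ⟨![a1, a2, a3], ![b1, b2, b3], ?_, ?_, ?_, ?_, ?_⟩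
  · exact inj3 ha21.symm (Ne.symm ha3'.1) ha32.symm
  · exact inj3 hb21.symm hb31.symm (Ne.symm hb3'.2)
  · intro i; fin_cases i <;> assumption
  · intro i; fin_cases i <;> assumption
  · intro i; fin_cases i <;> assumption

/-- A model of the special prism. -/
def PrismM {V : Type*} (G : SimpleGraph V) (S T : Set V) : Prop :=
  ∃ g h : V → Fin 3, (∀ i, CC G {x | x ∈ S ∧ g x = i}) ∧ (∀ i, CC G {x | x ∈ T ∧ h x = i}) ∧
    (∀ i j, i ≠ j → Touch G {x | x ∈ S ∧ g x = i} {x | x ∈ S ∧ g x = j}) ∧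
    (∀ i j, i ≠ j → Touch G {x | x ∈ T ∧ h x = i} {x | x ∈ T ∧ h x = j}) ∧
    ∀ i j, Touch G {x | x ∈ S ∧ g x = i} {x | x ∈ T ∧ h x = j} ↔ i = j

theorem K4M_or_PrismM {V : Type*} [Finite V] {G : SimpleGraph V} {S T : Set V}
    (h : Setup G S T) : K4M G S T ∨ PrismM G S T := by
  by_cases hK : K4M G S T
  · exact Or.inl hK
  right
  have kT := key h hK
  have kS := key h.symm (fun h' => hK h'.symm)
  obtain ⟨a, b, ha, hb, haS, hbT, hab⟩ := three_edges h (fun y hy => (kT y hy).2)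
    (fun x hx => (kS x hx).2)
  obtain ⟨g, g1, g2, g3, g4⟩ := rooted_triangle (fun x hx => (kS x hx).1) a haS ha
  obtain ⟨k, k1, k2, k3, k4⟩ := rooted_triangle (fun x hx => (kT x hx).1) b hbT hb
  refine ⟨g, k, g2, k2, g4, k4, ?_⟩
  intro i j
  constructor
  · rintro ht
    by_contra hij
    apply hK
    have eS : S \ {x | x ∈ S ∧ g x = i} = {x | x ∈ S ∧ g x ≠ i} := by
      ext x; simp only [Set.mem_sdiff, Set.mem_ofPred_eq]; tauto
    have eT : T \ {x | x ∈ T ∧ k x = j} = {x | x ∈ T ∧ k x ≠ j} := by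
      ext x; simp only [Set.mem_sdiff, Set.mem_ofPred_eq]; tauto
    obtain ⟨l, hli, hlj⟩ : ∃ l : Fin 3, l ≠ i ∧ l ≠ j := by
      clear ht hij eS eT
      revert i j; decide
    refine ⟨{x | x ∈ S ∧ g x = i}, fun x hx => hx.1, {x | x ∈ T ∧ k x = j}, fun x hx => hx.1,
      g2 i, eS ▸ g3 i, k2 j, eT ▸ k3 j, ht, ?_, ?_, ?_⟩
    · rw [eT]
      exact ⟨a i, ⟨haS i, g1 i⟩, b i, ⟨hbT i, by rw [k1]; exact hij⟩, hab i⟩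
    · rw [eS]
      exact ⟨a j, ⟨haS j, by rw [g1]; exact fun e => hij e.symm⟩, b j, ⟨hbT j, k1 j⟩, hab j⟩
    · rw [eS, eT]
      exact ⟨a l, ⟨haS l, by rw [g1]; exact hli⟩, b l, ⟨hbT l, by rw [k1]; exact hlj⟩, hab l⟩
  · rintro rfl
    exact ⟨a i, ⟨haS i, g1 i⟩, b i, ⟨hbT i, k1 i⟩, hab i⟩

/-! ### The two special graphs are good -/

theorem PC.comap {V W : Type*} {G : SimpleGraph V} {H : SimpleGraph W} (φ : G ≃g H) {A : Set W}
    (h : PC H A) : PC G (φ ⁻¹' A) := by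
  intro X hX hne hcl y hy
  have := h (φ '' X) (by rintro _ ⟨x, hx, rfl⟩; exact hX hx) (hne.image _) (by
    rintro _ ⟨x, hx, rfl⟩ b hb hxb
    obtain ⟨b, rfl⟩ := φ.surjective b
    exact ⟨b, hcl x hx b hb (φ.map_adj_iff.1 hxb), rfl⟩)
  obtain ⟨y', hy', e⟩ := this hy
  rwa [φ.injective e] at hy'

theorem CC.comap {V W : Type*} {G : SimpleGraph V} {H : SimpleGraph W} (φ : G ≃g H) {A : Set W}
    (h : CC H A) : CC G (φ ⁻¹' A) := by
  refine ⟨?_, h.2.comap φ⟩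
  obtain ⟨a, ha⟩ := h.1
  obtain ⟨x, rfl⟩ := φ.surjective a
  exact ⟨x, ha⟩

theorem mem_crossEdges {V : Type*} (G : SimpleGraph V) (S : Set V) (x y : V) :
    s(x, y) ∈ crossEdges G S ↔ G.Adj x y ∧ ((x ∈ S ∧ y ∉ S) ∨ (y ∈ S ∧ x ∉ S)) := by
  simp only [crossEdges, Set.mem_ofPred_eq, mem_edgeSet, Sym2.mem_iff, exists_eq_or_imp,
    exists_eq_left]
  tauto

theorem good_of_iso {W : Type} {H : SimpleGraph W} {Y : Set (Sym2 W)} (S : Set W) (hS : CC H S)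
    (hS' : CC H Sᶜ) (hX : ∀ x y, s(x, y) ∈ Y ↔ H.Adj x y ∧ ((x ∈ S ∧ y ∉ S) ∨ (y ∈ S ∧ x ∉ S)))
    (hcard : 2 < Nat.card W) (h0 : PC H Set.univ) (h1 : ∀ x, PC H {x}ᶜ)
    (h2 : ∀ x ∈ S, ∀ y ∈ Sᶜ, PC H {x, y}ᶜ) (hL : Touch H S S) (hR : Touch H Sᶜ Sᶜ)
    (C' : CGraph) (hiso : ∃ φ : C'.G ≃g H, Sym2.map φ '' C'.X = Y) : GoodAlong C' := by
  obtain ⟨φ, hφ⟩ := hiso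
  have hX' : ∀ x y, s(x, y) ∈ C'.X ↔ s(φ x, φ y) ∈ Y := by
    intro x y
    rw [← hφ]
    constructor
    · intro h
      exact ⟨_, h, rfl⟩
    · rintro ⟨e, he, h⟩
      have : Function.Injective (Sym2.map φ) := Sym2.map.injective φ.injective
      rwa [← this (show Sym2.map φ e = Sym2.map φ s(x, y) from h)]
  have c1 := hS.comap φ
  have c2 := hS'.comap φ
  rw [Set.preimage_compl] at c2
  have hcard' : 2 < Nat.card C'.V := by rwa [Nat.card_congr φ.toEquiv]
  have side : ∀ A : Set W, Touch H A A → (sideEdges C'.G (φ ⁻¹' A)).Nonempty := by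
    rintro A ⟨a, ha, b, hb, hab⟩
    obtain ⟨x, rfl⟩ := φ.surjective a
    obtain ⟨y, rfl⟩ := φ.surjective b
    refine ⟨s(x, y), φ.map_adj_iff.1 hab, ?_⟩
    intro v hv
    rcases Sym2.mem_iff.1 hv with rfl | rfl
    · exact ha
    · exact hb
  refine ⟨φ ⁻¹' S, ⟨⟨c1.1, c2.1, (cc_iff _ _).2 c1, (cc_iff _ _).2 c2, ?_⟩, ⟨hcard', ?_⟩, ?_⟩,
    side S hL, ?_⟩
  · ext e
    induction e using Sym2.ind with
    | _ x y =>
      rw [hX', hX, mem_crossEdges, φ.map_adj_iff]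
      rfl
  · intro A hA
    rw [cc_iff]
    refine ⟨?_, ?_⟩
    · by_contra hne
      rw [Set.not_nonempty_iff_eq_empty, Set.compl_empty_iff] at hne
      rw [hne, Set.ncard_univ] at hA
      omega
    · rcases (Set.ncard_le_one_iff_eq (Set.toFinite _)).1 (Nat.lt_succ_iff.1 hA) with rfl | ⟨x, rfl⟩
      · rw [Set.compl_empty]
        exact h0.comap φ
      · have := (h1 (φ x)).comap φ
        convert this using 1
        ext z
        simp
  · intro x hx y hy
    rw [pc_iff]
    have := (h2 (φ x) hx (φ y) hy).comap φ
    convert this using 1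
    ext z
    simp
  · have := side Sᶜ hR
    rwa [Set.preimage_compl] at this

theorem pc_top {V : Type*} (A : Set V) : PC (⊤ : SimpleGraph V) A := by
  intro X hX hne hcl y hy
  obtain ⟨x, hx⟩ := hne
  by_cases e : x = y
  · exact e ▸ hx
  · exact hcl x hx y hy e

theorem specialK4_bond (x y : Fin 4) :
    s(x, y) ∈ ({s(0, 2), s(0, 3), s(1, 2), s(1, 3)} : Set (Sym2 (Fin 4))) ↔
    (x.val < 2 ∧ ¬ y.val < 2) ∨ (y.val < 2 ∧ ¬ x.val < 2) := by
  simp only [Set.mem_insert_iff, Set.mem_singleton_iff, Sym2.eq_iff]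
  revert x y
  decide

theorem prism_adj (x y : Fin 6) : prismGraph.Adj x y ↔
    x ≠ y ∧ ((x.val < 3 ↔ y.val < 3) ∨ x.val % 3 = y.val % 3) := by
  simp only [prismGraph, fromEdgeSet_adj, Set.mem_insert_iff, Set.mem_singleton_iff, Sym2.eq_iff]
  revert x y
  decide

theorem specialPrism_bond (x y : Fin 6) :
    s(x, y) ∈ ({s(0, 3), s(1, 4), s(2, 5)} : Set (Sym2 (Fin 6))) ↔
    x ≠ y ∧ x.val % 3 = y.val % 3 := by
  simp only [Set.mem_insert_iff, Set.mem_singleton_iff, Sym2.eq_iff]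
  revert x y
  decide

theorem good_K4 (C' : CGraph) (h : CGIso C' specialK4) : GoodAlong C' := by
  refine good_of_iso (W := Fin 4) (H := ⊤)
    (Y := {s(0, 2), s(0, 3), s(1, 2), s(1, 3)}) {x : Fin 4 | x.val < 2}
    ⟨⟨(0 : Fin 4), show (0 : Fin 4).val < 2 by decide⟩, pc_top _⟩
    ⟨⟨(2 : Fin 4), show ¬ (2 : Fin 4).val < 2 by decide⟩, pc_top _⟩
    ?_ (by simp) (pc_top _) (fun _ => pc_top _)
    (fun _ _ _ _ => pc_top _) ?_ ?_ C' h
  · intro x y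
    rw [specialK4_bond x y]
    simp only [Set.mem_ofPred_eq, top_adj]
    revert x y
    decide
  · exact ⟨(0 : Fin 4), show (0 : Fin 4).val < 2 by decide, (1 : Fin 4),
      show (1 : Fin 4).val < 2 by decide, show (0 : Fin 4) ≠ 1 by decide⟩
  · exact ⟨(2 : Fin 4), show ¬ (2 : Fin 4).val < 2 by decide, (3 : Fin 4),
      show ¬ (3 : Fin 4).val < 2 by decide, show (2 : Fin 4) ≠ 3 by decide⟩

/-- Transfer to finsets for decidability. -/
theorem pc_prism (A : Finset (Fin 6)) (h : ∀ X ⊆ A, X.Nonempty →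
    (∀ x ∈ X, ∀ y ∈ A, (x ≠ y ∧ ((x.val < 3 ↔ y.val < 3) ∨ x.val % 3 = y.val % 3)) → y ∈ X) →
    A ⊆ X) : PC prismGraph (A : Set (Fin 6)) := by
  classical
  intro X hX hne hcl y hy
  have := h X.toFinset (fun x hx => hX (by simpa using hx)) (by simpa using hne) (by
    intro x hx y hy hxy
    simpa using hcl x (by simpa using hx) y hy ((prism_adj x y).2 hxy))
  simpa using this hy
set_option maxRecDepth 100000 in
theorem pc_prism_pair (x y : Fin 6) (hxy : x = y ∨ (x.val < 3 ∧ ¬ y.val < 3)) :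
    PC prismGraph ({x, y}ᶜ : Set (Fin 6)) := by
  have := pc_prism ({x, y}ᶜ : Finset (Fin 6)) (by
    revert x y
    decide +kernel)
  convert this using 1
  ext z
  simp [and_comm]

set_option maxRecDepth 100000 in
theorem good_prism (C' : CGraph) (h : CGIso C' specialPrism) : GoodAlong C' := by
  have hS : PC prismGraph {x : Fin 6 | x.val < 3} := by
    have := pc_prism ({0, 1, 2} : Finset (Fin 6)) (by decide +kernel)
    convert this using 1
    ext x
    simp only [Set.mem_ofPred_eq, Finset.mem_coe]
    revert x; decide
  have hT : PC prismGraph {x : Fin 6 | x.val < 3}ᶜ := by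
    have := pc_prism ({3, 4, 5} : Finset (Fin 6)) (by decide +kernel)
    convert this using 1
    ext x
    simp only [Set.mem_compl_iff, Set.mem_ofPred_eq, Finset.mem_coe]
    revert x; decide
  refine good_of_iso (W := Fin 6) (H := prismGraph)
    (Y := {s(0, 3), s(1, 4), s(2, 5)}) {x : Fin 6 | x.val < 3}
    ⟨⟨(0 : Fin 6), show (0 : Fin 6).val < 3 by decide⟩, hS⟩
    ⟨⟨(3 : Fin 6), show ¬ (3 : Fin 6).val < 3 by decide⟩, hT⟩ ?_ (by simp) ?_ ?_ ?_ ?_ ?_ C' h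
  · intro x y
    rw [specialPrism_bond x y, prism_adj]
    simp only [Set.mem_ofPred_eq]
    revert x y
    decide
  · have := pc_prism (Finset.univ : Finset (Fin 6)) (by decide +kernel)
    rw [Finset.coe_univ] at this
    exact this
  · intro x
    have := pc_prism_pair x x (Or.inl rfl)
    rw [Set.pair_eq_singleton] at this
    exact this
  · intro x hx y hy
    exact pc_prism_pair x y (Or.inr ⟨hx, hy⟩)
  · exact ⟨(0 : Fin 6), show (0 : Fin 6).val < 3 by decide, (1 : Fin 6),
      show (1 : Fin 6).val < 3 by decide, (prism_adj 0 1).2 (by decide)⟩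
  · exact ⟨(3 : Fin 6), show ¬ (3 : Fin 6).val < 3 by decide, (4 : Fin 6),
      show ¬ (4 : Fin 6).val < 3 by decide, (prism_adj 3 4).2 (by decide)⟩

/-! ### Building the models -/

theorem model_K4 {V : Type} {G : SimpleGraph V} {X : Set (Sym2 V)} {S : Set V}
    (hS : CC G S) (hT : CC G Sᶜ) (hX : X = crossEdges G S) (h : K4M G S Sᶜ) :
    ∃ f : V → Fin 4, Model G X (⊤ : SimpleGraph (Fin 4))
      {s(0, 2), s(0, 3), s(1, 2), s(1, 3)} f := by
  classical
  obtain ⟨A, hA, B, hB, c0, c1, c2, c3, t02, t03, t12, t13⟩ := h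
  have t01 : Touch G A (S \ A) := hS.2.touch hA c0.1 c1.1
  have t23 : Touch G B (Sᶜ \ B) := hT.2.touch hB c2.1 c3.1
  let f : V → Fin 4 := fun x => if x ∈ S then (if x ∈ A then 0 else 1) else
    (if x ∈ B then 2 else 3)
  let F : Fin 4 → Set V := ![A, S \ A, B, Sᶜ \ B]
  have hfF : ∀ i, f ⁻¹' {i} = F i := by
    intro i
    ext x
    have hxA := @hA x
    have hxB := @hB x
    rw [Set.mem_compl_iff] at hxB
    by_cases h1 : x ∈ S <;> by_cases h2 : x ∈ A <;> by_cases h3 : x ∈ B <;>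
      fin_cases i <;> simp_all [f, F]
  have hF : ∀ i, CC G (F i) := by
    intro i
    fin_cases i
    · exact c0
    · exact c1
    · exact c2
    · exact c3
  have hfS : ∀ x, (f x).val < 2 ↔ x ∈ S := by
    intro x
    by_cases h1 : x ∈ S <;> by_cases h2 : x ∈ A <;> by_cases h3 : x ∈ B <;> simp [f, h1, h2, h3]
  have hmem : ∀ i, ∀ x ∈ F i, f x = i := by
    intro i x hx
    rw [← hfF] at hx
    exact hx
  have ht : ∀ i j, i ≠ j → Touch G (F i) (F j) := by
    intro i j hij
    fin_cases i <;> fin_cases j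
    · exact (hij rfl).elim
    · exact t01
    · exact t02
    · exact t03
    · exact t01.symm
    · exact (hij rfl).elim
    · exact t12
    · exact t13
    · exact t02.symm
    · exact t12.symm
    · exact (hij rfl).elim
    · exact t23
    · exact t03.symm
    · exact t13.symm
    · exact t23.symm
    · exact (hij rfl).elim
  refine ⟨f, ?_, ?_, ?_, ?_⟩
  · intro i
    obtain ⟨x, hx⟩ := (hF i).1
    exact ⟨x, hmem i x hx⟩
  · intro i
    rw [hfF]
    exact (hF i).2
  · intro i j hij
    obtain ⟨x, hx, y, hy, hxy⟩ := ht i j hij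
    exact ⟨fun _ => ⟨x, y, hmem i x hx, hmem j y hy, hxy⟩, fun _ => hij⟩
  · intro x y
    rw [hX, mem_crossEdges, specialK4_bond, hfS, hfS]

theorem model_prism {V : Type} {G : SimpleGraph V} {X : Set (Sym2 V)} {S : Set V}
    (hX : X = crossEdges G S) (h : PrismM G S Sᶜ) :
    ∃ f : V → Fin 6, Model G X prismGraph {s(0, 3), s(1, 4), s(2, 5)} f := by
  classical
  obtain ⟨g, k, c1, c2, t1, t2, t3⟩ := h
  let f : V → Fin 6 := fun x => if x ∈ S then ⟨(g x).val, by omega⟩ else ⟨(k x).val + 3, by omega⟩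
  have fS : ∀ x, x ∈ S → (f x).val = (g x).val := by
    intro x hx
    simp [f, hx]
  have fT : ∀ x, x ∉ S → (f x).val = (k x).val + 3 := by
    intro x hx
    simp [f, hx]
  have hfS : ∀ x, (f x).val < 3 ↔ x ∈ S := by
    intro x
    by_cases hx : x ∈ S
    · rw [fS x hx]; simp [hx, (g x).isLt]
    · rw [fT x hx]; simp [hx]
  let F : Fin 6 → Set V := fun i => if h : i.val < 3 then {x | x ∈ S ∧ g x = ⟨i.val, h⟩} else
    {x | x ∈ Sᶜ ∧ k x = ⟨i.val - 3, by omega⟩}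
  have hfF : ∀ i, f ⁻¹' {i} = F i := by
    intro i
    ext x
    rw [Set.mem_preimage, Set.mem_singleton_iff, Fin.ext_iff]
    by_cases hi : i.val < 3
    · simp only [F, hi, dite_true, Set.mem_ofPred_eq, Fin.ext_iff]
      by_cases hx : x ∈ S
      · rw [fS x hx]; simp [hx]
      · rw [fT x hx]; simp only [hx, false_and, iff_false]; omega
    · simp only [F, hi, dite_false, Set.mem_ofPred_eq, Fin.ext_iff, Set.mem_compl_iff]
      by_cases hx : x ∈ S
      · rw [fS x hx]
        have := (g x).isLt
        simp only [hx, not_true, false_and, iff_false]; omega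
      · rw [fT x hx]; simp only [hx, not_false_iff, true_and]; omega
  have hF : ∀ i, CC G (F i) := by
    intro i
    by_cases hi : i.val < 3
    · simp only [F, hi, dite_true]; exact c1 _
    · simp only [F, hi, dite_false]; exact c2 _
  have ht : ∀ i j, i ≠ j → (Touch G (F i) (F j) ↔
      ((i.val < 3 ↔ j.val < 3) ∨ i.val % 3 = j.val % 3)) := by
    have hcross : ∀ i j : Fin 6, i.val < 3 → ¬ j.val < 3 → (Touch G (F i) (F j) ↔
        i.val % 3 = j.val % 3) := by
      intro i j hi hj
      simp only [F, hi, hj, dite_true, dite_false]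
      rw [t3, Fin.ext_iff]
      simp only
      omega
    intro i j hij
    rw [Ne, Fin.ext_iff] at hij
    by_cases hi : i.val < 3 <;> by_cases hj : j.val < 3
    · have : Touch G (F i) (F j) := by
        simp only [F, hi, hj, dite_true]
        exact t1 _ _ (by rw [Ne, Fin.ext_iff]; exact hij)
      simp [this, hi, hj]
    · rw [hcross i j hi hj]; simp [hi, hj]
    · have h1 : Touch G (F i) (F j) ↔ Touch G (F j) (F i) := ⟨Touch.symm, Touch.symm⟩
      rw [h1, hcross j i hj hi]; simp [hi, hj, eq_comm]
    · have : Touch G (F i) (F j) := by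
        simp only [F, hi, hj, dite_false]
        exact t2 _ _ (by rw [Ne, Fin.ext_iff]; simp only; omega)
      simp [this, hi, hj]
  have hmem : ∀ i x, x ∈ F i ↔ f x = i := by
    intro i x
    rw [← hfF]
    rfl
  have hadj : ∀ a b, a ≠ b → (prismGraph.Adj a b ↔ ∃ x y, f x = a ∧ f y = b ∧ G.Adj x y) := by
    intro i j hij
    rw [prism_adj, ← ht i j hij]
    constructor
    · rintro ⟨-, x, hx, y, hy, hxy⟩
      exact ⟨x, y, (hmem i x).1 hx, (hmem j y).1 hy, hxy⟩
    · rintro ⟨x, y, hx, hy, hxy⟩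
      exact ⟨hij, x, (hmem i x).2 hx, y, (hmem j y).2 hy, hxy⟩
  refine ⟨f, ?_, ?_, hadj, ?_⟩
  · intro i
    obtain ⟨x, hx⟩ := (hF i).1
    exact ⟨x, (hmem i x).1 hx⟩
  · intro i
    rw [hfF]
    exact (hF i).2
  · intro x y
    rw [hX, mem_crossEdges, specialPrism_bond, ← hfS, ← hfS]
    refine and_congr_right fun hxy => ?_
    constructor
    · intro hc
      have hne : f x ≠ f y := by
        intro e
        rw [e] at hc
        omega
      refine ⟨hne, ?_⟩
      have := ((prism_adj _ _).1 ((hadj _ _ hne).2 ⟨x, y, rfl, rfl, hxy⟩)).2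
      omega
    · rintro ⟨hne, hm⟩
      rw [Ne, Fin.ext_iff] at hne
      omega

theorem side_nontrivial {V : Type*} {G : SimpleGraph V} {S : Set V}
    (h : (sideEdges G S).Nonempty) : S.Nontrivial := by
  obtain ⟨e, he, hS⟩ := h
  induction e using Sym2.ind with
  | _ x y =>
    exact ⟨x, hS x (Sym2.mem_mk_left x y), y, hS y (Sym2.mem_mk_right x y), G.ne_of_adj he⟩

theorem specialK4_WF : specialK4.WF := by
  intro e he
  induction e using Sym2.ind with
  | _ x y =>
    have := (specialK4_bond x y).1 he
    change x ≠ y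
    rintro rfl
    exact absurd this (by tauto)

theorem specialPrism_WF : specialPrism.WF := by
  intro e he
  induction e using Sym2.ind with
  | _ x y =>
    have := (specialPrism_bond x y).1 he
    exact (prism_adj x y).2 ⟨this.1, Or.inr this.2⟩

/-- If `(Q, d)` is irreducible, `Q` is 3-connected along the bond `d` and both sides of `d`
contain edges, then `(Q, d)` is the special `K₄` or the special prism. -/
theorem irreducible_is_special (C : CGraph) (S : Set C.V) (h : ThreeConnAlong C.G C.X S)
    (hL : (sideEdges C.G S).Nonempty) (hR : (sideEdges C.G Sᶜ).Nonempty)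
    (hirr : BondIrreducible C) :
    CGIso C specialK4 ∨ CGIso C specialPrism := by
  obtain ⟨⟨-, -, hS, hT, hX⟩, ⟨-, hK⟩, h2⟩ := h
  rw [cc_iff] at hS hT
  have hset : Setup C.G S Sᶜ := by
    refine ⟨fun v => em _, fun v h1 h2 => h2 h1, hS, hT, ?_, ?_, ?_, side_nontrivial hL,
      side_nontrivial hR⟩
    · have := (cc_iff _ _).1 (hK ∅ (by simp))
      rw [Set.compl_empty] at this
      exact this.2
    · intro x
      exact ((cc_iff _ _).1 (hK {x} (by simp))).2
    · intro x hx y hy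
      exact (pc_iff _ _).1 (h2 x hx y hy)
  rcases K4M_or_PrismM hset with hM | hM
  · left
    obtain ⟨f, hf⟩ := model_K4 hS hT hX hM
    exact Model.conclude (D := specialK4) (f := f) hf specialK4_WF good_K4 hirr
  · right
    obtain ⟨f, hf⟩ := model_prism hX hM
    exact Model.conclude (D := specialPrism) (f := f) hf specialPrism_WF good_prism hirr
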